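/- arXiv:0810.2326 — 4 statements merged into one kernel-verified Lean document; each statement's English description precedes it below -/
import Mathlib

section
/- Let (Q, μ) be a measure space and E ⊆ ℝ. Let φ_n : ℝ → ℝ (n ∈ ℕ) be continuous nondecreasing functions converging pointwise on ℝ to a continuous function φ : ℝ → ℝ which is strictly increasing on ℝ ∖ E. Let I be an open interval with I ⊆ ℝ ∖ E, and let u_n, u : Q → ℝ be measurable functions such that φ_n(u_n(x)) → φ(u(x)) for μ-a.e. x ∈ Q. Then u_n(x) → u(x) for μ-a.e. x ∈ Q with u(x) ∈ I. -/
open MeasureTheory Filter Set Topology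

/-- **Lemma 6.1.** Let `φn` be continuous nondecreasing functions converging
pointwise to a continuous function `φ` which is strictly increasing on `ℝ \ E`.
Let `I = (a,b)` be an open interval contained in `ℝ \ E`, and suppose
`φn (un x) → φ (u x)` for μ-a.e. `x`. Then `un x → u x` for μ-a.e. `x` with
`u x ∈ I`. -/
theorem stmt1 {Q : Type*} [MeasurableSpace Q] (μ : Measure Q)
    (E : Set ℝ) (φn : ℕ → ℝ → ℝ) (φ : ℝ → ℝ)
    (hφnc : ∀ n, Continuous (φn n)) (hφnm : ∀ n, Monotone (φn n))
    (hconv : ∀ x : ℝ, Tendsto (fun n => φn n x) atTop (𝓝 (φ x)))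
    (hφc : Continuous φ)
    (hφE : ∀ x y : ℝ, x < y → x ∉ E → y ∉ E → φ x < φ y)
    (a b : ℝ) (hI : Set.Ioo a b ⊆ Eᶜ)
    (un : ℕ → Q → ℝ) (u : Q → ℝ)
    (hunm : ∀ n, Measurable (un n)) (hum : Measurable u)
    (hae : ∀ᵐ x ∂μ, Tendsto (fun n => φn n (un n x)) atTop (𝓝 (φ (u x)))) :
    ∀ᵐ x ∂μ, u x ∈ Set.Ioo a b → Tendsto (fun n => un n x) atTop (𝓝 (u x)) := by
  filter_upwards [hae] with x hx hu
  refine tendsto_order.2 ⟨fun c hc => ?_, fun c hc => ?_⟩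
  · obtain ⟨d, hd1, hd2⟩ := exists_between (max_lt hu.1 hc)
    have hda : a < d := lt_of_le_of_lt (le_max_left _ _) hd1
    have hdc : c < d := lt_of_le_of_lt (le_max_right _ _) hd1
    have h := hφE d (u x) hd2 (hI ⟨hda, hd2.trans hu.2⟩) (hI hu)
    filter_upwards [(hconv d).eventually_lt hx h] with n hn
    exact hdc.trans ((hφnm n).reflect_lt hn)
  · obtain ⟨d, hd1, hd2⟩ := exists_between (lt_min hu.2 hc)
    have hdb : d < b := lt_of_lt_of_le hd2 (min_le_left _ _)
    have hdc : d < c := lt_of_lt_of_le hd2 (min_le_right _ _)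
    have h := hφE (u x) d hd1 (hI hu) (hI ⟨hu.1.trans hd1, hdb⟩)
    filter_upwards [hx.eventually_lt (hconv d) h] with n hn
    exact ((hφnm n).reflect_lt hn).trans hdc
end

section
/- Let φ, ψ : ℝ → ℝ be nondecreasing functions, let a < a' < b' < b be real numbers, and set δ := min(φ(a') − φ(a), φ(b) − φ(b')). Assume δ > 0 and sup_{z ∈ [a,b]} |ψ(z) − φ(z)| < δ/2. Then for every u ∈ [a', b'] and every z ∈ ℝ with |ψ(z) − φ(u)| < δ/2 one has a < z < b. -/
open Set

/-- **Pointwise localization step in the proof of Lemma 6.1.**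
If `ψ, φ` are nondecreasing, `a < a' < b' < b`,
`δ = min (φ a' - φ a) (φ b - φ b') > 0`, and
`sup_{z ∈ [a,b]} |ψ z - φ z| < δ/2`, then for every `u ∈ [a',b']` and every
`z` with `|ψ z - φ u| < δ/2` one has `a < z < b`. -/
theorem stmt2 (φ ψ : ℝ → ℝ) (hφ : Monotone φ) (hψ : Monotone ψ)
    (a a' b' b : ℝ) (h1 : a < a') (h2 : a' < b') (h3 : b' < b)
    (δ : ℝ) (hδ : δ = min (φ a' - φ a) (φ b - φ b')) (hδpos : 0 < δ)
    (hclose : (⨆ z ∈ Set.Icc a b, |ψ z - φ z|) < δ / 2) :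
    ∀ u ∈ Set.Icc a' b', ∀ z : ℝ, |ψ z - φ u| < δ / 2 → a < z ∧ z < b := by
  have hbdd : BddAbove (Set.range fun z => ⨆ _ : z ∈ Set.Icc a b, |ψ z - φ z|) := by
    refine ⟨|ψ a| + |ψ b| + |φ a| + |φ b|, ?_⟩
    rintro _ ⟨z, rfl⟩
    refine Real.iSup_le (fun hz => ?_) (by positivity)
    have e1 := hψ hz.1
    have e2 := hψ hz.2
    have e3 := hφ hz.1
    have e4 := hφ hz.2
    have p1 := neg_abs_le (ψ a)
    have p2 := le_abs_self (ψ b)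
    have p3 := neg_abs_le (φ a)
    have p4 := le_abs_self (φ b)
    have q1 := abs_nonneg (ψ a)
    have q2 := abs_nonneg (ψ b)
    have q3 := abs_nonneg (φ a)
    have q4 := abs_nonneg (φ b)
    rw [abs_le]
    constructor <;> linarith
  have key : ∀ z ∈ Set.Icc a b, |ψ z - φ z| < δ / 2 := by
    intro z hz
    have h := le_ciSup hbdd z
    have e : (⨆ _ : z ∈ Set.Icc a b, |ψ z - φ z|) = |ψ z - φ z| := ciSup_pos hz
    simp only [e] at h
    exact lt_of_le_of_lt h hclose
  have hab : a ≤ b := by linarith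
  have ka := abs_lt.1 (key a ⟨le_refl a, hab⟩)
  have kb := abs_lt.1 (key b ⟨hab, le_refl b⟩)
  have d1 : δ ≤ φ a' - φ a := hδ ▸ min_le_left _ _
  have d2 : δ ≤ φ b - φ b' := hδ ▸ min_le_right _ _
  intro u hu z hz
  have hz' := abs_lt.1 hz
  have u1 := hφ hu.1
  have u2 := hφ hu.2
  constructor
  · by_contra hc
    have := hψ (not_lt.1 hc)
    linarith [ka.2, hz'.1]
  · by_contra hc
    have := hψ (not_lt.1 hc)
    linarith [kb.1, hz'.2]
end

section
/- Let G = {0} ∪ {1/√i : i ∈ ℕ, i ≥ 1} ⊆ ℝ, and for ε > 0 let G^ε = {z ∈ ℝ : dist(z, G) < ε} be its open ε-neighbourhood. Then, with λ denoting Lebesgue measure on ℝ, the ratio λ(G^ε)/ε tends to +∞ as ε → 0⁺; in particular liminf_{ε→0⁺} λ(G^ε)/ε = +∞. -/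
open MeasureTheory Filter Set Topology

lemma key_aux (G : Set ℝ) (f : ℕ → ℝ) (hf : Function.Injective f) (hG : ∀ i, f i ∈ G) (N : ℕ) :
    ∀ᶠ ε in 𝓝[>] (0:ℝ), ENNReal.ofReal (N * (2 * ε)) ≤ volume (Metric.thickening ε G) := by
  have h1 : ∀ᶠ ε in 𝓝[>] (0:ℝ), ∀ i ∈ Finset.range N, ∀ j ∈ Finset.range N,
      i ≠ j → ε + ε ≤ dist (f i) (f j) := by
    rw [Filter.eventually_all_finset]
    intro i _
    rw [Filter.eventually_all_finset]
    intro j _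
    by_cases hij : i = j
    · exact Eventually.of_forall fun _ h => absurd hij h
    · have hd : 0 < dist (f i) (f j) := dist_pos.2 fun h => hij (hf h)
      have : ∀ᶠ ε in 𝓝 (0:ℝ), ε < dist (f i) (f j) / 2 := eventually_lt_nhds (by linarith)
      filter_upwards [nhdsWithin_le_nhds this] with ε hε _
      linarith
  filter_upwards [h1, self_mem_nhdsWithin] with ε h hε
  have hε : 0 < ε := hε
  have hv : volume (⋃ i ∈ Finset.range N, Metric.ball (f i) ε) = ENNReal.ofReal (N * (2 * ε)) := by
    rw [measure_biUnion_finset]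
    · simp only [Real.volume_ball, Finset.sum_const, Finset.card_range, nsmul_eq_mul]
      rw [ENNReal.ofReal_mul (p := (N : ℝ)) (by positivity), ENNReal.ofReal_natCast]
    · intro i hi j hj hij
      exact Metric.ball_disjoint_ball (h i (by simpa using hi) j (by simpa using hj) hij)
    · intro i _
      exact measurableSet_ball
  rw [← hv]
  apply measure_mono
  intro x hx
  simp only [mem_iUnion] at hx
  obtain ⟨i, _, hx⟩ := hx
  exact Metric.mem_thickening_iff.2 ⟨f i, hG i, hx⟩

/-- **Remark 1.1(ii): failure of hypothesis (H₃).**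
For `G = {0} ∪ {1/√i : i ≥ 1}` the ratio `λ(G^ε)/ε` of the Lebesgue measure of
the open `ε`-neighbourhood `G^ε` of `G` to `ε` tends to `+∞` as `ε → 0⁺`;
in particular the liminf is `+∞`. -/
theorem stmt7 :
    Tendsto
      (fun ε : ℝ =>
        (volume (Metric.thickening ε
          ({0} ∪ {x : ℝ | ∃ i : ℕ, 1 ≤ i ∧ x = 1 / Real.sqrt i}))).toReal / ε)
      (𝓝[>] (0:ℝ)) atTop ∧
    Filter.liminf
      (fun ε : ℝ =>
        volume (Metric.thickening ε
          ({0} ∪ {x : ℝ | ∃ i : ℕ, 1 ≤ i ∧ x = 1 / Real.sqrt i})) /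
          ENNReal.ofReal ε)
      (𝓝[>] (0:ℝ)) = ⊤ := by
  have key := key_aux ({0} ∪ {x : ℝ | ∃ i : ℕ, 1 ≤ i ∧ x = 1 / Real.sqrt i})
    (fun i => 1 / Real.sqrt ((i + 1 : ℕ) : ℝ))
    (by
      intro i j h
      simp only [one_div, inv_inj] at h
      rw [Real.sqrt_inj (by positivity) (by positivity)] at h
      have := Nat.cast_injective h
      omega)
    (fun i => Or.inr ⟨i + 1, by omega, rfl⟩)
  have hb : Bornology.IsBounded
      ({0} ∪ {x : ℝ | ∃ i : ℕ, 1 ≤ i ∧ x = 1 / Real.sqrt i}) := by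
    apply (Metric.isBounded_Icc (0:ℝ) 1).subset
    rintro x (rfl | ⟨i, hi, rfl⟩)
    · simp
    · have : (1:ℝ) ≤ Real.sqrt i := Real.one_le_sqrt.2 (by exact_mod_cast hi)
      exact ⟨by positivity, by rw [div_le_one (by linarith)]; exact this⟩
  generalize ({0} ∪ {x : ℝ | ∃ i : ℕ, 1 ≤ i ∧ x = 1 / Real.sqrt i}) = G at key hb
  constructor
  · rw [tendsto_atTop]
    intro b
    obtain ⟨N, hN⟩ := exists_nat_ge b
    filter_upwards [key N, self_mem_nhdsWithin] with ε h hε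
    have hε : 0 < ε := hε
    have h2 := (ENNReal.ofReal_le_iff_le_toReal (hb.thickening (δ := ε)).measure_lt_top.ne).1 h
    rw [le_div_iff₀ hε]
    have h0 : (0:ℝ) ≤ N := by positivity
    nlinarith
  · apply Tendsto.liminf_eq
    rw [ENNReal.tendsto_nhds_top_iff_nat]
    intro n
    filter_upwards [key (n + 1), self_mem_nhdsWithin] with ε h hε
    have hε : 0 < ε := hε
    rw [ENNReal.lt_div_iff_mul_lt (Or.inl (by simpa using hε)) (Or.inl (by simp))]
    refine lt_of_lt_of_le ?_ h
    rw [← ENNReal.ofReal_natCast, ← ENNReal.ofReal_mul (by positivity)]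
    rw [ENNReal.ofReal_lt_ofReal_iff (by positivity)]
    push_cast
    have h0 : (0:ℝ) ≤ n := by positivity
    nlinarith
end

section
/- Let (Q, μ) be a measure space with 0 < μ(Q) < ∞, let M > 0, and let v, y : Q → [−M, M] be measurable functions. Let π : [0, ∞) → [0, ∞) be continuous, concave, strictly increasing and unbounded with π(0) = 0; let Π : [0, ∞) → [0, ∞) be its inverse, set Π̄(r) := r·Π(r), and let π̄ : [0, ∞) → [0, ∞) be the inverse of Π̄. Let h : ℝ → ℝ satisfy |h(s) − h(t)| ≤ π(|s − t|) for all s, t ∈ [−M, M]. Then ∫_Q |h(v(x)) − h(y(x))| dμ(x) ≤ μ(Q) · π̄( (1/μ(Q)) ∫_Q |v(x) − y(x)| · |h(v(x)) − h(y(x))| dμ(x) ). -/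
open MeasureTheory Set

/-- Supporting line of a strictly increasing concave function at an interior point. -/
lemma aux_support (π : ℝ → ℝ) (hconc : ConcaveOn ℝ (Set.Ici 0) π)
    (hmono : StrictMonoOn π (Set.Ici 0)) (a : ℝ) (ha : 0 < a) :
    ∃ c : ℝ, 0 < c ∧ ∀ d, 0 ≤ d → π d ≤ π a + c * (d - a) := by
  set S : Set ℝ := (fun z => (π z - π a) / (z - a)) '' Set.Ioi a with hS
  have key : ∀ x, 0 ≤ x → x < a → ∀ q ∈ S, q ≤ (π a - π x) / (a - x) := by
    rintro x hx hxa q ⟨z, hz, rfl⟩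
    exact hconc.slope_anti_adjacent (Set.mem_Ici.2 hx)
      (Set.mem_Ici.2 (ha.le.trans (le_of_lt hz))) hxa hz
  have hbdd : BddAbove S := ⟨_, fun q hq => key 0 le_rfl ha q hq⟩
  have hmem : ∀ z, a < z → (π z - π a) / (z - a) ∈ S := fun z hz => ⟨z, hz, rfl⟩
  refine ⟨sSup S, ?_, ?_⟩
  · have h1 := le_csSup hbdd (hmem (a + 1) (by linarith))
    have h2 : π a < π (a + 1) :=
      hmono (Set.mem_Ici.2 ha.le) (Set.mem_Ici.2 (by linarith)) (by linarith)
    have h3 : 0 < (π (a + 1) - π a) / (a + 1 - a) := div_pos (by linarith) (by linarith)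
    linarith
  · intro d hd
    rcases lt_trichotomy d a with hlt | rfl | hgt
    · have h1 : sSup S ≤ (π a - π d) / (a - d) :=
        csSup_le ⟨_, hmem (a + 1) (by linarith)⟩ (key d hd hlt)
      rw [le_div_iff₀ (by linarith)] at h1
      linarith
    · simp
    · have h1 := le_csSup hbdd (hmem d hgt)
      rw [div_le_iff₀ (by linarith)] at h1
      linarith

/-- **Modulus-of-continuity estimate (proof of Lemma 5.1(iii)).**
With `π` a concave modulus with inverse `Pinv`, `Pibar r = r * Pinv r`, and
`pibar` the inverse of `Pibar`, if `|h s - h t| ≤ π |s - t|` on `[-M, M]` and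
`v, y : Q → [-M, M]` are measurable on a measure space with `0 < μ(Q) < ∞`,
then `∫ |h∘v - h∘y| dμ ≤ μ(Q) · pibar( (1/μ(Q)) ∫ |v - y|·|h∘v - h∘y| dμ )`. -/
theorem stmt11 {Q : Type*} [MeasurableSpace Q] (μ : Measure Q) [IsFiniteMeasure μ]
    (hμpos : 0 < (μ Set.univ).toReal)
    (M : ℝ) (hM : 0 < M)
    (v y : Q → ℝ) (hv : Measurable v) (hy : Measurable y)
    (hvM : ∀ x, v x ∈ Set.Icc (-M) M) (hyM : ∀ x, y x ∈ Set.Icc (-M) M)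
    (π Pinv pibar : ℝ → ℝ)
    (hπc : ContinuousOn π (Set.Ici 0))
    (hπconc : ConcaveOn ℝ (Set.Ici 0) π)
    (hπmono : StrictMonoOn π (Set.Ici 0))
    (hπunbdd : ¬ BddAbove (π '' Set.Ici 0))
    (hπ0 : π 0 = 0)
    (hπnonneg : ∀ x ∈ Set.Ici (0:ℝ), 0 ≤ π x)
    (hPinv1 : ∀ x ∈ Set.Ici (0:ℝ), Pinv (π x) = x)
    (hPinv2 : ∀ t ∈ Set.Ici (0:ℝ), π (Pinv t) = t)
    (hPinvnonneg : ∀ t ∈ Set.Ici (0:ℝ), 0 ≤ Pinv t)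
    (hpibar1 : ∀ r ∈ Set.Ici (0:ℝ), pibar (r * Pinv r) = r)
    (hpibar2 : ∀ t ∈ Set.Ici (0:ℝ), (pibar t) * Pinv (pibar t) = t)
    (hpibarnonneg : ∀ t ∈ Set.Ici (0:ℝ), 0 ≤ pibar t)
    (h : ℝ → ℝ)
    (hh : ∀ s ∈ Set.Icc (-M) M, ∀ t ∈ Set.Icc (-M) M, |h s - h t| ≤ π |s - t|) :
    ∫ x, |h (v x) - h (y x)| ∂μ ≤
      (μ Set.univ).toReal *
        pibar (((μ Set.univ).toReal)⁻¹ *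
          ∫ x, |v x - y x| * |h (v x) - h (y x)| ∂μ) := by
  have hcont : ContinuousOn h (Set.Icc (-M) M) := by
    intro s hs
    have h0 : Filter.Tendsto (fun t => π |t - s|) (nhdsWithin s (Set.Icc (-M) M)) (nhds 0) := by
      have h1 : Filter.Tendsto π (nhdsWithin 0 (Set.Ici 0)) (nhds 0) := by
        have := hπc 0 (Set.mem_Ici.2 le_rfl)
        rw [ContinuousWithinAt, hπ0] at this
        exact this
      refine h1.comp (tendsto_nhdsWithin_iff.2 ⟨?_, Filter.Eventually.of_forall fun t => Set.mem_Ici.2 (abs_nonneg _)⟩)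
      have h2 : Continuous fun t : ℝ => |t - s| := by fun_prop
      have h3 := (h2.tendsto s).mono_left (nhdsWithin_le_nhds (s := Set.Icc (-M) M))
      simpa using h3
    rw [ContinuousWithinAt, tendsto_iff_dist_tendsto_zero]
    refine squeeze_zero' (Filter.Eventually.of_forall fun t => dist_nonneg) ?_ h0
    filter_upwards [self_mem_nhdsWithin] with t ht
    exact hh t ht s hs
  have hmeas : ∀ u : Q → ℝ, Measurable u → (∀ x, u x ∈ Set.Icc (-M) M) →
      Measurable fun x => h (u x) := by
    intro u hu huM
    exact (continuousOn_iff_continuous_domRestrict.1 hcont).measurable.comp (hu.subtype_mk (h := huM))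
  have hwm : Measurable fun x => |h (v x) - h (y x)| := by
    have := (hmeas v hv hvM).sub (hmeas y hy hyM)
    exact measurable_abs.comp this
  have hdm : Measurable fun x => |v x - y x| := measurable_abs.comp (hv.sub hy)
  have hdb : ∀ x, |v x - y x| ≤ 2 * M := by
    intro x
    have h1 := hvM x
    have h2 := hyM x
    rw [abs_le]
    constructor <;> linarith [h1.1, h1.2, h2.1, h2.2]
  have hwπ : ∀ x, |h (v x) - h (y x)| ≤ π |v x - y x| := fun x => hh _ (hvM x) _ (hyM x)
  have hwb : ∀ x, |h (v x) - h (y x)| ≤ π (2 * M) := fun x =>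
    (hwπ x).trans (hπmono.monotoneOn (Set.mem_Ici.2 (abs_nonneg _))
      (Set.mem_Ici.2 (by linarith)) (hdb x))
  have hwi : Integrable (fun x => |h (v x) - h (y x)|) μ :=
    Integrable.of_bound hwm.aestronglyMeasurable (π (2 * M))
      (Filter.Eventually.of_forall fun x => by simpa using hwb x)
  have hdwi : Integrable (fun x => |v x - y x| * |h (v x) - h (y x)|) μ :=
    Integrable.of_bound (hdm.mul hwm).aestronglyMeasurable (2 * M * π (2 * M))
      (Filter.Eventually.of_forall fun x => by
        rw [Real.norm_eq_abs, abs_mul, abs_abs, abs_abs]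
        exact mul_le_mul (hdb x) (hwb x) (abs_nonneg _) (by linarith))
  set m := (μ Set.univ).toReal with hm
  set I := ∫ x, |h (v x) - h (y x)| ∂μ with hI
  set J := ∫ x, |v x - y x| * |h (v x) - h (y x)| ∂μ with hJ
  have hJ0 : 0 ≤ J := integral_nonneg fun x => mul_nonneg (abs_nonneg _) (abs_nonneg _)
  have hB0 : 0 ≤ m⁻¹ * J := mul_nonneg (inv_nonneg.2 hμpos.le) hJ0
  have hp0 := hpibarnonneg _ (Set.mem_Ici.2 hB0)
  have hpB := hpibar2 _ (Set.mem_Ici.2 hB0)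
  set p := pibar (m⁻¹ * J) with hp
  by_contra hcon
  rw [not_le] at hcon
  obtain ⟨A, hA⟩ : ∃ A, I = m * A := ⟨m⁻¹ * I, by field_simp⟩
  have hpA : p < A := by
    rw [hA] at hcon
    exact lt_of_mul_lt_mul_left hcon hμpos.le
  have hA0 : 0 < A := lt_of_le_of_lt hp0 hpA
  have ha0 := hPinvnonneg A (Set.mem_Ici.2 hA0.le)
  have haA := hPinv2 A (Set.mem_Ici.2 hA0.le)
  set a := Pinv A with ha
  have hapos : 0 < a := by
    rcases ha0.lt_or_eq with h1 | h1
    · exact h1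
    · rw [← h1, hπ0] at haA
      linarith
  have hle : Pinv p ≤ a := by
    by_contra hlt
    rw [not_le] at hlt
    have h1 := hπmono (Set.mem_Ici.2 ha0) (Set.mem_Ici.2 (hPinvnonneg p hp0)) hlt
    rw [haA, hPinv2 p hp0] at h1
    linarith
  obtain ⟨c, hc, hsup⟩ := aux_support π hπconc hπmono a hapos
  have hpt : ∀ x, (c * a + A) * |h (v x) - h (y x)| - A ^ 2 ≤
      c * (|v x - y x| * |h (v x) - h (y x)|) := by
    intro x
    have h1 := (hwπ x).trans (hsup _ (abs_nonneg (v x - y x)))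
    rw [haA] at h1
    have h2 := mul_le_mul_of_nonneg_right h1 (abs_nonneg (h (v x) - h (y x)))
    nlinarith [sq_nonneg (|h (v x) - h (y x)| - A)]
  have hint := integral_mono ((hwi.const_mul (c * a + A)).sub (integrable_const (A ^ 2)))
    (hdwi.const_mul c) hpt
  have hL : ∫ x, ((c * a + A) * |h (v x) - h (y x)| - A ^ 2) ∂μ = (c * a + A) * I - m * A ^ 2 := by
    rw [integral_sub (hwi.const_mul _) (integrable_const _), integral_const_mul, integral_const,
      smul_eq_mul]
    rfl
  have hR : ∫ x, c * (|v x - y x| * |h (v x) - h (y x)|) ∂μ = c * J := integral_const_mul _ _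
  have hfin : (c * a + A) * I - m * A ^ 2 ≤ c * J := by
    rw [← hL, ← hR]
    exact hint
  have hJm : J = m * (p * Pinv p) := by
    rw [hpB]
    field_simp
  have h5 : p * Pinv p < A * a :=
    lt_of_le_of_lt (mul_le_mul_of_nonneg_left hle hp0) (mul_lt_mul_of_pos_right hpA hapos)
  rw [hJm, hA] at hfin
  have h6 : c * m * (A * a) ≤ c * m * (p * Pinv p) := by nlinarith
  exact absurd (le_of_mul_le_mul_left h6 (mul_pos hc hμpos)) (not_le.2 h5)
end
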